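/- Let (M,ω) be an n-plectic manifold. The set X_Ham(M) of Hamiltonian vector fields on M is a Lie subalgebra of the Lie algebra of vector fields on M (i.e., it is a subspace closed under the Lie bracket of vector fields), and the map φ: Ham^{n−1}(M) → X_Ham(M) sending a Hamiltonian (n−1)-form α to its Hamiltonian vector field v_α is a surjective linear map satisfying φ({α,β}) = [φ(α), φ(β)]. -/

import Mathlib

open scoped Classical

/-- An abstract setting for the Cartan calculus on a smooth manifold `M`:
the points of `M`, its tangent spaces, the spaces `Ω^k(M)` of (smooth) differential
`k`-forms, the space `𝔛(M)` of (smooth) vector fields, together with the de Rham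
differential `d`, interior products `ι`, the wedge product, and the Lie bracket of
vector fields, satisfying the standard identities of the Cartan calculus.
(`Form k` plays the role of `Ω^k(M)`, and `iota k : VF → Form k →ₗ Form (k-1)` is the
interior product, which vanishes on `Form 0`.) -/
structure CartanCalculus where
  /-- the points of the manifold -/
  Point : Type
  /-- the tangent space at each point -/
  Tangent : Point → Type
  [tangentAddCommGroup : ∀ x, AddCommGroup (Tangent x)]
  [tangentModule : ∀ x, Module ℝ (Tangent x)]
  /-- the space of smooth differential `k`-forms -/
  Form : ℕ → Type
  [formAddCommGroup : ∀ k, AddCommGroup (Form k)]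
  [formModule : ∀ k, Module ℝ (Form k)]
  /-- the space of smooth vector fields -/
  VF : Type
  [vfAddCommGroup : AddCommGroup VF]
  [vfModule : Module ℝ VF]
  /-- evaluation of a vector field at a point -/
  evalVF : VF →ₗ[ℝ] ((x : Point) → Tangent x)
  /-- evaluation of a `k`-form at a point, as an alternating multilinear map on the
  tangent space -/
  evalForm : (k : ℕ) → Form k →ₗ[ℝ] ((x : Point) → (Tangent x) [⋀^Fin k]→ₗ[ℝ] ℝ)
  /-- the constant function `1 ∈ Ω^0(M) = C^∞(M)` -/
  one : Form 0
  /-- the de Rham (exterior) differential -/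
  d : (k : ℕ) → Form k →ₗ[ℝ] Form (k+1)
  /-- the interior product (contraction) of a vector field with a form; it is the zero map
  on `0`-forms -/
  iota : (k : ℕ) → VF →ₗ[ℝ] Form k →ₗ[ℝ] Form (k-1)
  /-- the wedge product of forms -/
  wedge : (k l : ℕ) → Form k →ₗ[ℝ] Form l →ₗ[ℝ] Form (k+l)
  /-- the Lie bracket of vector fields -/
  bracketVF : VF →ₗ[ℝ] VF →ₗ[ℝ] VF
  /-- vector fields are determined by their pointwise values -/
  evalVF_injective : Function.Injective evalVF
  /-- every tangent vector is the value of some (smooth) vector field -/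
  evalVF_surjective : ∀ (x : Point) (v : Tangent x), ∃ X, evalVF X x = v
  /-- forms are determined by their pointwise values -/
  evalForm_injective : ∀ k, Function.Injective (evalForm k)
  evalForm_one : ∀ x, evalForm 0 one x (fun i => i.elim0) = 1
  d_one : d 0 one = 0
  d_d : ∀ (k : ℕ) (α : Form k), d (k+1) (d k α) = 0
  iota_zero : iota 0 = 0
  evalForm_iota : ∀ (k : ℕ) (X : VF) (α : Form (k+1)) (x : Point) (u : Fin k → Tangent x),
    evalForm k (iota (k+1) X α) x u = evalForm (k+1) α x (Fin.cons (evalVF X x) u)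
  evalForm_wedge : ∀ (k l : ℕ) (α : Form k) (β : Form l) (x : Point)
      (v : Fin (k+l) → Tangent x),
    evalForm (k+l) (wedge k l α β) x v
      = ((k.factorial * l.factorial : ℝ))⁻¹ *
          ∑ σ : Equiv.Perm (Fin (k+l)),
            ((Equiv.Perm.sign σ : ℤ) : ℝ) *
              (evalForm k α x (fun i => v (σ (Fin.castAdd l i))) *
               evalForm l β x (fun i => v (σ (Fin.natAdd k i))))
  d_wedge : ∀ (k l : ℕ) (α : Form k) (β : Form l),
    d (k+l) (wedge k l α β)
      = cast (congrArg Form (by omega : (k+1)+l = (k+l)+1)) (wedge (k+1) l (d k α) β)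
        + (show Form ((k+l)+1) from ((-1 : ℤ)^k) • wedge k (l+1) α (d l β))
  bracketVF_skew : ∀ X Y, bracketVF X Y = - bracketVF Y X
  bracketVF_jacobi : ∀ X Y Z,
    bracketVF X (bracketVF Y Z)
      = bracketVF (bracketVF X Y) Z + bracketVF Y (bracketVF X Z)
  /-- the Cartan commutator identity `ι_{[X,Y]} = [L_X, ι_Y]`, where
  `L_X = d ∘ ι_X + ι_X ∘ d` is the Lie derivative -/
  iota_bracketVF : ∀ (k : ℕ) (X Y : VF) (α : Form (k+2)),
    iota (k+2) (bracketVF X Y) α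
      = d k (iota (k+1) X (iota (k+2) Y α))
        + (show Form (k+1) from iota (k+2) X (d (k+1) (iota (k+2) Y α)))
        - (show Form (k+1) from iota (k+2) Y
            ((show Form (k+2) from d (k+1) (iota (k+2) X α))
              + (show Form (k+2) from iota (k+3) X (d (k+2) α))))

attribute [instance] CartanCalculus.tangentAddCommGroup CartanCalculus.tangentModule
  CartanCalculus.formAddCommGroup CartanCalculus.formModule
  CartanCalculus.vfAddCommGroup CartanCalculus.vfModule

namespace CartanCalculus

variable (S : CartanCalculus)

/-- The de Rham differential `Ω^{k-1}(M) → Ω^k(M)`, interpreted as the zero map for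
`k = 0` (i.e. `Ω^{-1}(M) = 0`). -/
def dLow : (k : ℕ) → S.Form (k-1) →ₗ[ℝ] S.Form k
  | 0 => 0
  | (r+1) => S.d r

/-- The Lie derivative of a `k`-form along a vector field, via Cartan's magic formula
`L_X = d ∘ ι_X + ι_X ∘ d`. -/
def lieD (k : ℕ) (X : S.VF) (α : S.Form k) : S.Form k :=
  S.dLow k (S.iota k X α) + (show S.Form k from S.iota (k+1) X (S.d k α))

/-- `ω` is an `n`-plectic structure: it is a closed `(n+1)`-form which is nondegenerate,
i.e. for every point `x` and tangent vector `v` at `x`, `ι_v ω = 0` implies `v = 0`. -/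
def IsPlectic (n : ℕ) (ω : S.Form (n+1)) : Prop :=
  S.d (n+1) ω = 0 ∧
    ∀ (x : S.Point) (v : S.Tangent x),
      (∀ u : Fin n → S.Tangent x, S.evalForm (n+1) ω x (Fin.cons v u) = 0) → v = 0

/-- `X` is a Hamiltonian vector field for the `(n-1)`-form `α`, i.e. `dα = -ι_X ω`.
Here and below the `n`-plectic case is parametrized as `n = m + 1`, so that the
`n`-plectic form `ω` has degree `m + 2 = n + 1` and Hamiltonian forms have
degree `m = n - 1`. -/
def IsHamPair (m : ℕ) (ω : S.Form (m+2)) (α : S.Form m) (X : S.VF) : Prop :=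
  S.d m α = - S.iota (m+2) X ω

/-- `α` is a Hamiltonian `(n-1)`-form (with `n = m+1`). -/
def IsHamiltonian (m : ℕ) (ω : S.Form (m+2)) (α : S.Form m) : Prop :=
  ∃ X, S.IsHamPair m ω α X

/-- The bracket `{α, β} = ι_{v_β} ι_{v_α} ω` of Hamiltonian `(n-1)`-forms, expressed in
terms of their Hamiltonian vector fields `X = v_α` and `Y = v_β`. -/
def hamBracket (m : ℕ) (ω : S.Form (m+2)) (X Y : S.VF) : S.Form m :=
  S.iota (m+1) Y (S.iota (m+2) X ω)

/-- The iterated interior product `ι(v₁ ∧ ⋯ ∧ v_k) α = ι_{v_k} ⋯ ι_{v_1} α` of a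
decomposable multivector field with a form. -/
def itIota (N : ℕ) : (k : ℕ) → (Fin k → S.VF) → S.Form N → S.Form (N - k)
  | 0, _, α => α
  | (k+1), v, α => S.iota (N - k) (v (Fin.last k)) (itIota N k (fun i => v i.castSucc) α)

/-- The Hamiltonian vector field of `α` (an arbitrary one when it exists; it is unique by
nondegeneracy, and we set it to `0` when `α` is not Hamiltonian). -/
noncomputable def hamVF (m : ℕ) (ω : S.Form (m+2)) (α : S.Form m) : S.VF :=
  if h : S.IsHamiltonian m ω α then h.choose else 0

/-- The vector space of Hamiltonian `(n-1)`-forms (with `n = m+1`). -/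
def hamSubmodule (m : ℕ) (ω : S.Form (m+2)) : Submodule ℝ (S.Form m) where
  carrier := {α | S.IsHamiltonian m ω α}
  zero_mem' := ⟨0, by simp [IsHamPair]⟩
  add_mem' := by
    rintro a b ⟨X, hX⟩ ⟨Y, hY⟩
    refine ⟨X + Y, ?_⟩
    simp only [IsHamPair] at *
    simp [map_add, LinearMap.add_apply, hX, hY]
    abel
  smul_mem' := by
    rintro c a ⟨X, hX⟩
    refine ⟨c • X, ?_⟩
    simp only [IsHamPair] at *
    simp [map_smul, LinearMap.smul_apply, hX]

/-- The subspace `dΩ^{n-2}(M)` of exact `(n-1)`-forms (with `n = m+1`; for `n = 1` this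
is the zero subspace). -/
def exactSubmodule (m : ℕ) : Submodule ℝ (S.Form m) :=
  LinearMap.range (S.dLow m)

section Complex

/-- The underlying space of the `n`-term complex
`C^∞(M) → Ω^1(M) → ⋯ → Ω^{n-2}(M) → Ω^{n-1}(M)` (with `n = m+1`): families of forms
of degrees `0, …, m`.  The graded piece of (complex) degree `i` consists of those
families supported in form-degree `m - i`, and the honest complex `L` further requires
the degree-`m` form (the complex-degree-`0` component) to be Hamiltonian; see
`IsHomogeneous` and `InComplex` below. -/
def cochainSpace (m : ℕ) : Submodule ℝ ((p : ℕ) → S.Form p) where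
  carrier := {f | ∀ p, m < p → f p = 0}
  zero_mem' := fun p _ => rfl
  add_mem' := by
    intro a b ha hb p hp
    show a p + b p = 0
    rw [ha p hp, hb p hp, add_zero]
  smul_mem' := by
    intro c a ha p hp
    show c • a p = 0
    rw [ha p hp, smul_zero]

/-- An element of the complex underlying the Lie `n`-algebra. -/
abbrev Cochain (m : ℕ) := ↥(S.cochainSpace m)

/-- `x` is homogeneous of (complex) degree `i`, i.e. concentrated in form-degree `m - i`
(recall `L_i = Ω^{n-1-i}(M)` for `i > 0` and `L_0 = Ham^{n-1}(M) ⊆ Ω^{n-1}(M)`,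
with `n = m+1`). -/
def IsHomogeneous (m i : ℕ) (x : S.Cochain m) : Prop :=
  i ≤ m ∧ ∀ p, p ≠ m - i → (x : (p : ℕ) → S.Form p) p = 0

/-- `x` belongs to the complex `L` (the degree-`0` component must be Hamiltonian). -/
def InComplex (m : ℕ) (ω : S.Form (m+2)) (x : S.Cochain m) : Prop :=
  S.IsHamiltonian m ω ((x : (p : ℕ) → S.Form p) m)

/-- The element of the complex concentrated in form-degree `p₀` with value `γ`. -/
def singleCochain (m p₀ : ℕ) (hp : p₀ ≤ m) (γ : S.Form p₀) : S.Cochain m :=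
  ⟨fun p => if h : p = p₀ then cast (congrArg S.Form h.symm) γ else 0,
   fun p hp' => dif_neg (by omega)⟩

/-- The differential `l₁` of the complex: the de Rham differential on components of
positive complex degree (form-degree `< m`), and `0` on the degree-`0` part. -/
def ell1 (m : ℕ) (x : S.Cochain m) : S.Cochain m :=
  ⟨fun p => Nat.casesOn p (0 : S.Form 0)
      (fun q => if q + 1 ≤ m then S.d q ((x : (p : ℕ) → S.Form p) q) else 0),
   by
    intro p hp
    cases p with
    | zero => exact absurd hp (Nat.not_lt_zero m)
    | succ q => exact if_neg (by omega)⟩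

/-- The sign `(-1)^{k/2+1}` for `k` even and `(-1)^{(k-1)/2}` for `k` odd, appearing in
the definition of the multibrackets `l_k`. -/
def signCoef (k : ℕ) : ℤ :=
  if Even k then (-1)^(k/2+1) else (-1)^((k-1)/2)

/-- The multibrackets `l_k` of the Lie `n`-algebra `L_∞(M,ω)`: `l_1` is the
differential of the complex, and for `k ≥ 2`, `l_k` vanishes except on arguments of
(complex) degree `0`, where it is `±ι(v_{α_1} ∧ ⋯ ∧ v_{α_k}) ω` placed in
form-degree `m+2-k`, with sign given by `signCoef`. -/
noncomputable def ell (m : ℕ) (ω : S.Form (m+2)) :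
    (k : ℕ) → (Fin k → S.Cochain m) → S.Cochain m
  | 0, _ => 0
  | 1, x => S.ell1 m (x 0)
  | (k+2), x =>
      S.singleCochain m (m - k) (Nat.sub_le m k)
        (signCoef (k+2) •
          cast (congrArg S.Form (by omega : m + 2 - (k+2) = m - k))
            (S.itIota (m+2) (k+2)
              (fun i => S.hamVF m ω ((x i : (p : ℕ) → S.Form p) m)) ω))

/-- The Koszul sign `ε(σ; x_1, …, x_k)` of a permutation `σ`, where the argument `x_a`
has degree `D a`: the sign picked up from the graded commutations, not including the
sign `(-1)^σ` of the permutation. -/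
def koszulSign (k : ℕ) (D : Fin k → ℕ) (σ : Equiv.Perm (Fin k)) : ℤ :=
  ∏ p ∈ Finset.univ.filter (fun p : Fin k × Fin k => p.1 < p.2 ∧ σ p.2 < σ p.1),
    (-1 : ℤ) ^ (D (σ p.1) * D (σ p.2))

/-- `σ` is an `(i, N-i)`-unshuffle: `σ(a) < σ(a+1)` whenever `a + 1 ≠ i`
(`0`-indexed). -/
def IsUnshuffle (N i : ℕ) (σ : Equiv.Perm (Fin N)) : Prop :=
  ∀ a b : Fin N, (a : ℕ) + 1 = (b : ℕ) → (b : ℕ) ≠ i → σ a < σ b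

/-- The bracket `⟦x, y⟧ = L_{v_x} y` of the differential graded Leibniz algebra: the Lie
derivative of `y` along the Hamiltonian vector field of the degree-`0` part of `x`. -/
noncomputable def leibBracket (m : ℕ) (ω : S.Form (m+2)) (x y : S.Cochain m) :
    S.Cochain m :=
  ⟨fun p => S.lieD p (S.hamVF m ω ((x : (p : ℕ) → S.Form p) m))
      ((y : (p : ℕ) → S.Form p) p),
   by
    intro p hp
    show S.lieD p _ ((y : (p : ℕ) → S.Form p) p) = 0
    rw [y.2 p hp]
    simp [lieD]⟩

end Complex

section Hamiltonian

variable {S} {m : ℕ} {ω : S.Form (m+2)}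

theorem iota_iota_swap (k : ℕ) (X Y : S.VF) (α : S.Form (k+2)) :
    S.iota (k+1) X (S.iota (k+2) Y α) = - S.iota (k+1) Y (S.iota (k+2) X α) := by
  apply S.evalForm_injective k
  funext x
  ext u
  have eval_iota_iota (A B : S.VF) :
      S.evalForm k (S.iota (k+1) A (S.iota (k+2) B α)) x u
        = S.evalForm (k+2) α x
            (Fin.cons (S.evalVF B x) (Fin.cons (S.evalVF A x) u : Fin (k+1) → S.Tangent x)) :=
    (S.evalForm_iota k A _ x u).trans (S.evalForm_iota (k+1) B α x _)
  have hswap := (S.evalForm (k+2) α x).map_swap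
    (Fin.cons (S.evalVF X x) (Fin.cons (S.evalVF Y x) u : Fin (k+1) → S.Tangent x))
    (i := 0) (j := 1) (by simp)
  have hcons : (Fin.cons (S.evalVF X x) (Fin.cons (S.evalVF Y x) u : Fin (k+1) → S.Tangent x) :
        Fin (k+2) → S.Tangent x) ∘ Equiv.swap 0 1
      = Fin.cons (S.evalVF Y x) (Fin.cons (S.evalVF X x) u : Fin (k+1) → S.Tangent x) := by
    funext i
    refine Fin.cases ?_ (fun i => Fin.cases ?_ (fun i => ?_) i) i
    · simp only [Function.comp_apply, Equiv.swap_apply_left]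
      rfl
    · simp only [Function.comp_apply, Fin.succ_zero_eq_one, Equiv.swap_apply_right]
      rfl
    · rw [Function.comp_apply, Equiv.swap_apply_of_ne_of_ne (Fin.succ_ne_zero _)
        (by simp [Fin.ext_iff])]
      rfl
  rw [hcons] at hswap
  have hneg : S.evalForm k (- S.iota (k+1) Y (S.iota (k+2) X α)) x u
      = - S.evalForm k (S.iota (k+1) Y (S.iota (k+2) X α)) x u := by
    rw [map_neg]
    rfl
  exact (eval_iota_iota X Y).trans (hswap.trans
    ((congrArg Neg.neg (eval_iota_iota Y X)).symm.trans hneg.symm))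

theorem IsPlectic.iota_injective (hω : S.IsPlectic (m+1) ω) {X Y : S.VF}
    (h : S.iota (m+2) X ω = S.iota (m+2) Y ω) : X = Y := by
  rw [← sub_eq_zero]
  apply S.evalVF_injective
  funext x
  rw [map_zero]
  refine hω.2 x _ fun u => ?_
  have hzero : S.iota (m+2) (X - Y) ω = 0 := by
    rw [map_sub, LinearMap.sub_apply, h, sub_self]
  have heval : S.evalForm (m+1) (S.iota (m+2) (X - Y) ω) x u = 0 := by
    rw [hzero]
    simp
  exact (S.evalForm_iota (m+1) (X - Y) ω x u).symm.trans heval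

theorem IsHamPair.zero : S.IsHamPair m ω 0 0 := by
  simp [IsHamPair]

theorem IsHamPair.add {α β : S.Form m} {X Y : S.VF}
    (hX : S.IsHamPair m ω α X) (hY : S.IsHamPair m ω β Y) :
    S.IsHamPair m ω (α + β) (X + Y) := by
  simp only [IsHamPair] at *
  rw [map_add, map_add, LinearMap.add_apply, hX, hY, neg_add]

theorem IsHamPair.smul (c : ℝ) {α : S.Form m} {X : S.VF} (hX : S.IsHamPair m ω α X) :
    S.IsHamPair m ω (c • α) (c • X) := by
  simp only [IsHamPair] at *
  rw [map_smul, map_smul, LinearMap.smul_apply, hX, smul_neg]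

theorem IsHamPair.d_iota {α : S.Form m} {X : S.VF} (hX : S.IsHamPair m ω α X) :
    S.d (m+1) (S.iota (m+2) X ω) = 0 := by
  have h : S.iota (m+2) X ω = - S.d m α := by rw [hX, neg_neg]
  rw [h]
  exact (map_neg (S.d (m+1)) _).trans (by rw [S.d_d, neg_zero])

theorem IsHamPair.bracket (hω : S.d (m+2) ω = 0) {α β : S.Form m} {X Y : S.VF}
    (hX : S.IsHamPair m ω α X) (hY : S.IsHamPair m ω β Y) :
    S.IsHamPair m ω (S.hamBracket m ω X Y) (S.bracketVF X Y) := by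
  have h := S.iota_bracketVF m X Y ω
  simp only [hX.d_iota, hY.d_iota, hω, map_zero, add_zero, sub_zero] at h
  rw [iota_iota_swap, map_neg] at h
  exact (neg_eq_iff_eq_neg.mpr h).symm

theorem IsHamPair.hamVF_eq (hω : S.IsPlectic (m+1) ω) {α : S.Form m} {X : S.VF}
    (hX : S.IsHamPair m ω α X) : S.hamVF m ω α = X := by
  have h : S.IsHamiltonian m ω α := ⟨X, hX⟩
  rw [hamVF, dif_pos h]
  exact hω.iota_injective (neg_injective (h.choose_spec.symm.trans hX))

end Hamiltonian

/-- Let `(M, ω)` be an `n`-plectic manifold (here `n = m + 1`).  The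
set `X_Ham(M)` of Hamiltonian vector fields on `M` is a Lie subalgebra of the Lie
algebra of vector fields on `M` (a subspace closed under the Lie bracket of vector
fields), and the map `φ = hamVF : Ham^{n-1}(M) → X_Ham(M)`, sending a Hamiltonian
`(n-1)`-form `α` to its Hamiltonian vector field `v_α`, is a surjective linear map
satisfying `φ({α, β}) = [φ(α), φ(β)]`. -/
theorem hamiltonianVF_lie_subalgebra
    (m : ℕ) (ω : S.Form (m+2)) (hω : S.IsPlectic (m+1) ω) :
    -- `X_Ham(M)` is a linear subspace …
    (∃ W : Submodule ℝ S.VF,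
        (W : Set S.VF) = {X : S.VF | ∃ α : S.Form m, S.IsHamPair m ω α X}) ∧
    -- … closed under the Lie bracket of vector fields;
    (∀ X Y : S.VF, (∃ α : S.Form m, S.IsHamPair m ω α X) →
        (∃ β : S.Form m, S.IsHamPair m ω β Y) →
        ∃ γ : S.Form m, S.IsHamPair m ω γ (S.bracketVF X Y)) ∧
    -- `φ = hamVF` sends each Hamiltonian form to its (unique) Hamiltonian vector field,
    (∀ (α : S.Form m) (X : S.VF), S.IsHamPair m ω α X → S.hamVF m ω α = X) ∧
    -- `φ` is additive and homogeneous on `Ham^{n-1}(M)` (i.e. linear), …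
    (∀ α β : S.Form m, S.IsHamiltonian m ω α → S.IsHamiltonian m ω β →
        S.hamVF m ω (α + β) = S.hamVF m ω α + S.hamVF m ω β) ∧
    (∀ (c : ℝ) (α : S.Form m), S.IsHamiltonian m ω α →
        S.hamVF m ω (c • α) = c • S.hamVF m ω α) ∧
    -- … surjective onto `X_Ham(M)`, …
    (∀ X : S.VF, (∃ α : S.Form m, S.IsHamPair m ω α X) →
        ∃ α : S.Form m, S.IsHamiltonian m ω α ∧ S.hamVF m ω α = X) ∧
    -- … and `φ({α,β}) = [φ(α), φ(β)]`.
    (∀ α β : S.Form m, S.IsHamiltonian m ω α → S.IsHamiltonian m ω β →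
        S.hamVF m ω (S.hamBracket m ω (S.hamVF m ω α) (S.hamVF m ω β))
          = S.bracketVF (S.hamVF m ω α) (S.hamVF m ω β)) := by
  refine ⟨⟨⟨⟨⟨{X | ∃ α, S.IsHamPair m ω α X}, ?_⟩, ⟨0, IsHamPair.zero⟩⟩, ?_⟩, rfl⟩,
    ?_, fun α X hX => hX.hamVF_eq hω, ?_, ?_, ?_, ?_⟩
  · rintro X Y ⟨α, hX⟩ ⟨β, hY⟩
    exact ⟨α + β, hX.add hY⟩
  · rintro c X ⟨α, hX⟩
    exact ⟨c • α, hX.smul c⟩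
  · rintro X Y ⟨α, hX⟩ ⟨β, hY⟩
    exact ⟨_, hX.bracket hω.1 hY⟩
  · rintro α β ⟨X, hX⟩ ⟨Y, hY⟩
    rw [hX.hamVF_eq hω, hY.hamVF_eq hω, (hX.add hY).hamVF_eq hω]
  · rintro c α ⟨X, hX⟩
    rw [hX.hamVF_eq hω, (hX.smul c).hamVF_eq hω]
  · rintro X ⟨α, hX⟩
    exact ⟨α, ⟨X, hX⟩, hX.hamVF_eq hω⟩
  · rintro α β ⟨X, hX⟩ ⟨Y, hY⟩
    rw [hX.hamVF_eq hω, hY.hamVF_eq hω, (hX.bracket hω.1 hY).hamVF_eq hω]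

end CartanCalculus
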